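/- There exists a constant C > 0 such that for every Schwartz function v : ℝ² → ℂ one has ‖∇(⟨x⟩ v)‖²_{L²} + ‖ |x| ⟨x⟩ v ‖²_{L²} ≤ C ‖A v‖²_{L²}. -/

import Mathlib

open MeasureTheory Complex

noncomputable section

abbrev E2 : Type := EuclideanSpace ℝ (Fin 2)

/-- Partial derivative in the `i`-th coordinate direction. -/
noncomputable def pd (i : Fin 2) (f : E2 → ℂ) : E2 → ℂ :=
  fun x => fderiv ℝ f x (EuclideanSpace.single i 1)

/-- The Laplacian on `ℝ²`. -/
noncomputable def lap (f : E2 → ℂ) : E2 → ℂ :=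
  fun x => ∑ i : Fin 2, pd i (pd i f) x

/-- The harmonic oscillator `A f = -Δ f + |x|² f`. -/
noncomputable def Aop (f : E2 → ℂ) : E2 → ℂ :=
  fun x => -lap f x + (‖x‖ : ℂ)^2 * f x

/-- Time derivative of a time-dependent function. -/
noncomputable def tderiv (F : ℝ → E2 → ℂ) : ℝ → E2 → ℂ :=
  fun t x => deriv (fun s => F s x) t

/-- Squared euclidean norm of the gradient, `|∇f|²(x)`. -/
noncomputable def gradSq (f : E2 → ℂ) (x : E2) : ℝ := ∑ i : Fin 2, ‖pd i f x‖^2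

/-- The `L²` norm. -/
noncomputable def L2norm (f : E2 → ℂ) : ℝ := Real.sqrt (∫ x : E2, ‖f x‖^2)

/-- The `ℋ¹` norm: `(‖∇φ‖² + ‖|x|φ‖²)^(1/2)`. -/
noncomputable def H1norm (f : E2 → ℂ) : ℝ :=
  Real.sqrt ((∫ x : E2, gradSq f x) + ∫ x : E2, ‖x‖^2 * ‖f x‖^2)

/-- A Schwartz-regular solution of the cubic NLS with harmonic potential,
`i ∂ₜ u - Δu + |x|² u + σ u |u|² = 0`. -/
def IsSolution (σ : ℝ) (u : ℝ → SchwartzMap E2 ℂ) : Prop :=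
  ContDiff ℝ (⊤ : ℕ∞) (fun p : ℝ × E2 => u p.1 p.2) ∧
  ∀ (t : ℝ) (x : E2), Complex.I * deriv (fun s => u s x) t - lap (fun y => u t y) x
    + (‖x‖ : ℂ)^2 * u t x + (σ : ℂ) * u t x * (‖u t x‖ : ℂ)^2 = 0

/-- A Schwartz-regular solution of the linear Schrödinger equation with harmonic
potential, `i ∂ₜ w - Δw + |x|² w = 0`. -/
def IsLinSolution (w : ℝ → SchwartzMap E2 ℂ) : Prop :=
  ContDiff ℝ (⊤ : ℕ∞) (fun p : ℝ × E2 => w p.1 p.2) ∧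
  ∀ (t : ℝ) (x : E2), Complex.I * deriv (fun s => w s x) t - lap (fun y => w t y) x
    + (‖x‖ : ℂ)^2 * w t x = 0

/-- Partial derivative for real-valued functions. -/
noncomputable def pdR (i : Fin 2) (f : E2 → ℝ) : E2 → ℝ :=
  fun x => fderiv ℝ f x (EuclideanSpace.single i 1)

/-- The Laplacian for real-valued functions. -/
noncomputable def lapR (f : E2 → ℝ) : E2 → ℝ :=
  fun x => ∑ i : Fin 2, pdR i (pdR i f) x

open scoped SchwartzMap LineDeriv

/-- Multiplication by the `j`-th coordinate on Schwartz functions. -/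
def coordMul (j : Fin 2) (f : 𝓢(E2, ℂ)) : 𝓢(E2, ℂ) :=
  SchwartzMap.smulLeftCLM ℂ (fun x : E2 => x j) f

/-- The partial derivative `∂ᵢ` on Schwartz functions. -/
def schwartzPd (i : Fin 2) (f : 𝓢(E2, ℂ)) : 𝓢(E2, ℂ) :=
  ∂_{(EuclideanSpace.single i (1 : ℝ) : E2)} f

/-- Multiplication by `|x|²` on Schwartz functions. -/
def normSqMul (f : 𝓢(E2, ℂ)) : 𝓢(E2, ℂ) :=
  coordMul 0 (coordMul 0 f) + coordMul 1 (coordMul 1 f)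

/-- The harmonic oscillator on Schwartz functions. -/
def schwartzAop (f : 𝓢(E2, ℂ)) : 𝓢(E2, ℂ) :=
  normSqMul f - (schwartzPd 0 (schwartzPd 0 f) + schwartzPd 1 (schwartzPd 1 f))

/-- The product-rule expansion of `∂ᵢ Re(f̄ g)`. -/
def pdInner (i : Fin 2) (f g : 𝓢(E2, ℂ)) (x : E2) : ℝ :=
  inner ℝ (f x) (schwartzPd i g x) + inner ℝ (schwartzPd i f x) (g x)

lemma norm_sq_eq_coord (x : E2) : ‖x‖ ^ 2 = x 0 ^ 2 + x 1 ^ 2 := by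
  simp [EuclideanSpace.norm_sq_eq, Fin.sum_univ_two]

lemma coordMul_apply (j : Fin 2) (f : 𝓢(E2, ℂ)) (x : E2) :
    coordMul j f x = x j • f x := by
  have h : Function.HasTemperateGrowth (fun x : E2 => x j) :=
    (EuclideanSpace.proj j : E2 →L[ℝ] ℝ).hasTemperateGrowth
  exact SchwartzMap.smulLeftCLM_apply_apply h f x

lemma normSqMul_apply (f : 𝓢(E2, ℂ)) (x : E2) :
    normSqMul f x = (‖x‖ ^ 2) • f x := by
  simp only [normSqMul, add_apply, coordMul_apply, smul_smul, ← add_smul, norm_sq_eq_coord,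
    ← pow_two]

lemma schwartzPd_apply (i : Fin 2) (f : 𝓢(E2, ℂ)) (x : E2) :
    schwartzPd i f x = pd i f x :=
  SchwartzMap.lineDerivOp_apply_eq_fderiv _ f x

lemma schwartzPd_add (i : Fin 2) (f g : 𝓢(E2, ℂ)) :
    schwartzPd i (f + g) = schwartzPd i f + schwartzPd i g :=
  LineDeriv.lineDerivOp_add _ f g

lemma schwartzPd_coordMul (i j : Fin 2) (f : 𝓢(E2, ℂ)) (x : E2) :
    schwartzPd i (coordMul j f) x = (if i = j then f x else 0) + x j • schwartzPd i f x := by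
  have hx : HasFDerivAt (fun y : E2 => y j) (EuclideanSpace.proj j : E2 →L[ℝ] ℝ) x :=
    (EuclideanSpace.proj j : E2 →L[ℝ] ℝ).hasFDerivAt
  have h := hx.fun_smul (f.hasFDerivAt x)
  have he : (coordMul j f : E2 → ℂ) = fun y => y j • f y := funext (coordMul_apply j f)
  rw [schwartzPd_apply, schwartzPd_apply, pd, pd, he, h.fderiv]
  by_cases hij : i = j
  · subst hij
    simp [add_comm]
  · simp [hij, Ne.symm hij, add_comm]

lemma schwartzAop_apply (f : 𝓢(E2, ℂ)) (x : E2) : schwartzAop f x = Aop (fun y => f y) x := by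
  have h (i : Fin 2) : pd i f = schwartzPd i f := funext fun y => (schwartzPd_apply i f y).symm
  have h' (i : Fin 2) : pd i (schwartzPd i f) = schwartzPd i (schwartzPd i f) :=
    funext fun y => (schwartzPd_apply i _ y).symm
  have h0 : (fun y => f y) = (f : E2 → ℂ) := rfl
  simp only [schwartzAop, Aop, lap, Fin.sum_univ_two, h0, h, h', sub_apply,
    add_apply, normSqMul_apply, Complex.real_smul]
  push_cast
  ring

lemma integrable_inner_schwartz (f g : 𝓢(E2, ℂ)) :
    Integrable (fun x => inner ℝ (f x) (g x)) :=
  (SchwartzMap.pairing (innerSL ℝ) f g).integrable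

lemma integrable_norm_sq_schwartz (f : 𝓢(E2, ℂ)) : Integrable (fun x => ‖f x‖ ^ 2) := by
  simpa only [real_inner_self_eq_norm_sq] using integrable_inner_schwartz f f

lemma integrable_pdInner (i : Fin 2) (f g : 𝓢(E2, ℂ)) : Integrable (pdInner i f g) :=
  (integrable_inner_schwartz _ _).add (integrable_inner_schwartz _ _)

lemma integral_pdInner (i : Fin 2) (f g : 𝓢(E2, ℂ)) : ∫ x, pdInner i f g x = 0 := by
  have h : ∫ x, inner ℝ (f x) (schwartzPd i g x) = -∫ x, inner ℝ (schwartzPd i f x) (g x) :=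
    SchwartzMap.integral_bilinear_lineDerivOp_right_eq_neg_left (μ := volume) f g
      (innerSL ℝ) (EuclideanSpace.single i (1 : ℝ) : E2)
  unfold pdInner
  rw [integral_add (integrable_inner_schwartz _ _) (integrable_inner_schwartz _ _), h,
    neg_add_cancel]

lemma pd_weight_mul (i : Fin 2) (v : 𝓢(E2, ℂ)) (x : E2) :
    pd i (fun y => (Real.sqrt (1 + ‖y‖ ^ 2) : ℂ) * v y) x =
      Real.sqrt (1 + ‖x‖ ^ 2) • schwartzPd i v x + (x i / Real.sqrt (1 + ‖x‖ ^ 2)) • v x := by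
  have hp : (1 : ℝ) + ‖x‖ ^ 2 ≠ 0 := by positivity
  have hw := (((hasStrictFDerivAt_norm_sq x).hasFDerivAt).const_add (1 : ℝ)).sqrt hp
  have h := hw.fun_smul (v.hasFDerivAt x)
  have he : (fun y => (Real.sqrt (1 + ‖y‖ ^ 2) : ℂ) * v y) =
      fun y : E2 => Real.sqrt (1 + ‖y‖ ^ 2) • v y := by
    funext y
    rw [Complex.real_smul]
  rw [schwartzPd_apply, pd, pd, he, h.fderiv]
  have hs : Real.sqrt (1 + ‖x‖ ^ 2) ≠ 0 := by positivity
  simp [EuclideanSpace.inner_single_right]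
  field_simp
  exact Or.inl trivial

/-- The integrable majorant of `|∇(⟨x⟩v)|²`. -/
def gradMajorant (v : 𝓢(E2, ℂ)) (x : E2) : ℝ :=
  2 * ((‖schwartzPd 0 v x‖ ^ 2 + ‖coordMul 0 (schwartzPd 0 v) x‖ ^ 2
      + ‖coordMul 1 (schwartzPd 0 v) x‖ ^ 2)
    + (‖schwartzPd 1 v x‖ ^ 2 + ‖coordMul 0 (schwartzPd 1 v) x‖ ^ 2
      + ‖coordMul 1 (schwartzPd 1 v) x‖ ^ 2)
    + ‖v x‖ ^ 2)

lemma integrable_gradMajorant (v : 𝓢(E2, ℂ)) : Integrable (gradMajorant v) := by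
  have h := integrable_norm_sq_schwartz
  exact (((((h _).add (h _)).add (h _)).add (((h _).add (h _)).add (h _))).add (h _)).const_mul 2

lemma norm_add_sq_le_two_mul (a b : ℂ) : ‖a + b‖ ^ 2 ≤ 2 * ‖a‖ ^ 2 + 2 * ‖b‖ ^ 2 := by
  have h := norm_add_le a b
  nlinarith [norm_nonneg (a + b), sq_nonneg (‖a‖ - ‖b‖)]

lemma gradSq_weight_le (v : 𝓢(E2, ℂ)) (x : E2) :
    gradSq (fun y => (Real.sqrt (1 + ‖y‖ ^ 2) : ℂ) * v y) x ≤ gradMajorant v x := by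
  have hp : (0 : ℝ) < 1 + ‖x‖ ^ 2 := by positivity
  have key (i : Fin 2) := norm_add_sq_le_two_mul (Real.sqrt (1 + ‖x‖ ^ 2) • schwartzPd i v x)
    ((x i / Real.sqrt (1 + ‖x‖ ^ 2)) • v x)
  have h0 := key 0
  have h1 := key 1
  simp only [norm_smul, mul_pow, Real.norm_eq_abs, sq_abs, div_pow, Real.sq_sqrt hp.le] at h0 h1
  simp only [gradSq, Fin.sum_univ_two, pd_weight_mul, gradMajorant, coordMul_apply, norm_smul,
    mul_pow, Real.norm_eq_abs, sq_abs]
  have hr : x 0 ^ 2 / (1 + ‖x‖ ^ 2) + x 1 ^ 2 / (1 + ‖x‖ ^ 2) ≤ 1 := by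
    rw [← add_div, ← norm_sq_eq_coord, div_le_one hp]
    linarith
  have hv := mul_le_mul_of_nonneg_right hr (sq_nonneg ‖v x‖)
  have hn := norm_sq_eq_coord x
  generalize x 0 ^ 2 / (1 + ‖x‖ ^ 2) = s at *
  generalize x 1 ^ 2 / (1 + ‖x‖ ^ 2) = t at *
  rw [hn] at h0 h1
  rw [hn]
  linarith

lemma weighted_norm_sq_eq (v : 𝓢(E2, ℂ)) (x : E2) :
    ‖x‖ ^ 2 * (1 + ‖x‖ ^ 2) * ‖v x‖ ^ 2 =
      ‖coordMul 0 v x‖ ^ 2 + ‖coordMul 1 v x‖ ^ 2 + ‖normSqMul v x‖ ^ 2 := by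
  simp only [normSqMul_apply, coordMul_apply, norm_smul, mul_pow, Real.norm_eq_abs, sq_abs,
    norm_sq_eq_coord]
  ring

/-- The divergence terms produced by the integrations by parts. -/
def divergenceTerm (v : 𝓢(E2, ℂ)) (x : E2) : ℝ :=
  14 * (pdInner 0 v (schwartzPd 0 v) x + pdInner 1 v (schwartzPd 1 v) x)
    + 8 * (pdInner 0 (coordMul 0 v) v x + pdInner 1 (coordMul 1 v) v x)
    + 4 * (pdInner 0 (normSqMul v) (schwartzPd 0 v) x
      + pdInner 1 (normSqMul v) (schwartzPd 1 v) x)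

lemma integrable_divergenceTerm (v : 𝓢(E2, ℂ)) : Integrable (divergenceTerm v) := by
  have h := integrable_pdInner
  exact ((((h _ _ _).add (h _ _ _)).const_mul 14).add
    (((h _ _ _).add (h _ _ _)).const_mul 8)).add (((h _ _ _).add (h _ _ _)).const_mul 4)

lemma integral_divergenceTerm (v : 𝓢(E2, ℂ)) : ∫ x, divergenceTerm v x = 0 := by
  have hs (i j : Fin 2) (f g f' g' : 𝓢(E2, ℂ)) (c : ℝ) :
      Integrable (fun x => c * (pdInner i f g x + pdInner j f' g' x)) ∧
      ∫ x, c * (pdInner i f g x + pdInner j f' g' x) = 0 := by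
    refine ⟨((integrable_pdInner _ _ _).add (integrable_pdInner _ _ _)).const_mul c, ?_⟩
    rw [integral_const_mul, integral_add (integrable_pdInner _ _ _) (integrable_pdInner _ _ _),
      integral_pdInner, integral_pdInner, add_zero, mul_zero]
  unfold divergenceTerm
  rw [integral_add ((hs _ _ _ _ _ _ _).1.fun_add (hs _ _ _ _ _ _ _).1) (hs _ _ _ _ _ _ _).1,
    integral_add (hs _ _ _ _ _ _ _).1 (hs _ _ _ _ _ _ _).1, (hs _ _ _ _ _ _ _).2,
    (hs _ _ _ _ _ _ _).2, (hs _ _ _ _ _ _ _).2, add_zero, add_zero]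

/-- The real-valued pointwise inequality: `v`, `p`, `q`, `s`, `t` stand for the value, the two first
derivatives and the two pure second derivatives at the point `(a, b)`. -/
lemma pointwise_bound_real (a b v p q s t : ℝ) :
    2 * (1 + (a ^ 2 + b ^ 2)) * (p ^ 2 + q ^ 2) + 2 * v ^ 2
      + (a ^ 2 + b ^ 2) * (1 + (a ^ 2 + b ^ 2)) * v ^ 2 ≤
    6 * ((a ^ 2 + b ^ 2) * v - (s + t)) ^ 2
      + 14 * (p ^ 2 + q ^ 2 + v * (s + t))
      + 8 * (2 * v ^ 2 + 2 * v * (a * p + b * q))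
      + 4 * (2 * v * (a * p + b * q) + (a ^ 2 + b ^ 2) * (p ^ 2 + q ^ 2)
        + (a ^ 2 + b ^ 2) * v * (s + t)) := by
  set r := a ^ 2 + b ^ 2 with hr
  have hr0 : 0 ≤ r := by positivity
  set L := r * v - (s + t) with hL
  set P := p ^ 2 + q ^ 2
  have hst : s + t = r * v - L := by rw [hL]; ring
  rw [hst]
  have hgap : 0 ≤ P + r * v ^ 2 + 2 * v * (a * p + b * q) := by
    have : P + r * v ^ 2 + 2 * v * (a * p + b * q) = (p + a * v) ^ 2 + (q + b * v) ^ 2 := by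
      simp only [P, hr]; ring
    rw [this]; positivity
  have hP : 0 ≤ P := by positivity
  linarith [sq_nonneg (3 * (r * v) - 2 * L), sq_nonneg (2 * v - L),
    mul_nonneg hr0 (sq_nonneg v), mul_nonneg hr0 hP, sq_nonneg L]

lemma pointwise_bound (v : 𝓢(E2, ℂ)) (x : E2) :
    gradMajorant v x + ‖x‖ ^ 2 * (1 + ‖x‖ ^ 2) * ‖v x‖ ^ 2 ≤
      6 * ‖schwartzAop v x‖ ^ 2 + divergenceTerm v x := by
  have hre := pointwise_bound_real (x 0) (x 1) (v x).re (schwartzPd 0 v x).re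
    (schwartzPd 1 v x).re (schwartzPd 0 (schwartzPd 0 v) x).re (schwartzPd 1 (schwartzPd 1 v) x).re
  have him := pointwise_bound_real (x 0) (x 1) (v x).im (schwartzPd 0 v x).im
    (schwartzPd 1 v x).im (schwartzPd 0 (schwartzPd 0 v) x).im (schwartzPd 1 (schwartzPd 1 v) x).im
  simp only [gradMajorant, divergenceTerm, pdInner, schwartzAop, normSqMul, schwartzPd_add,
    sub_apply, add_apply, schwartzPd_coordMul, coordMul_apply,
    Complex.sq_norm, Complex.normSq_apply, norm_sq_eq_coord, Complex.inner,
    Complex.real_smul, Complex.add_re, Complex.add_im, Complex.sub_re, Complex.sub_im,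
    Complex.mul_re, Complex.mul_im, Complex.conj_re, Complex.conj_im, Complex.ofReal_re,
    Complex.ofReal_im, if_true, if_false, Fin.isValue, zero_ne_one, one_ne_zero,
    Complex.zero_re, Complex.zero_im]
  linarith

/-- `⟨A(⟨x⟩v), ⟨x⟩v⟩ = ‖∇(⟨x⟩v)‖² + ‖|x|⟨x⟩v‖² ≤ C ‖Av‖²_{L²}` for Schwartz functions. -/
theorem weight_quadratic_form_bound :
    ∃ C : ℝ, 0 < C ∧ ∀ v : SchwartzMap E2 ℂ,
      (∫ x : E2, gradSq (fun y => (Real.sqrt (1 + ‖y‖^2) : ℂ) * v y) x)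
          + (∫ x : E2, ‖x‖^2 * (1 + ‖x‖^2) * ‖v x‖^2)
        ≤ C * ∫ x : E2, ‖Aop (fun y => v y) x‖^2 := by
  refine ⟨6, by norm_num, fun v => ?_⟩
  have hg := integral_mono_of_nonneg
    (ae_of_all _ fun x => Finset.sum_nonneg fun i _ => sq_nonneg _)
    (integrable_gradMajorant v) (ae_of_all volume (gradSq_weight_le v))
  have hw : Integrable (fun x : E2 => ‖x‖ ^ 2 * (1 + ‖x‖ ^ 2) * ‖v x‖ ^ 2) := by
    have h := integrable_norm_sq_schwartz
    simp only [weighted_norm_sq_eq]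
    exact ((h _).add (h _)).add (h _)
  have hA := (integrable_norm_sq_schwartz (schwartzAop v)).const_mul 6
  have hm := integral_mono ((integrable_gradMajorant v).add hw)
    (hA.add (integrable_divergenceTerm v)) (pointwise_bound v)
  rw [integral_add' (integrable_gradMajorant v) hw,
    integral_add' hA (integrable_divergenceTerm v), integral_divergenceTerm,
    integral_const_mul, add_zero] at hm
  simp only [← schwartzAop_apply]
  linarith
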